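/- arXiv:0805.3767 — 2 statements merged into one kernel-verified Lean document; each statement's English description precedes it below -/
import Mathlib

section
/- For every δ with 0 < δ < 1/4 there exist j₀ and c > 0 such that for all points (j, −j²), (j', −j'²) ∈ P with |j| > j₀, |j'| > j₀ and |j| ≠ |j'|, and any admissible side lengths for Λ_j and Λ_{j'}, the unique eigenvalue E_j of H_{Λ_j} in [−2δ, 2δ] and the unique eigenvalue E_{j'} of H_{Λ_{j'}} in [−2δ, 2δ] satisfy |E_j − E_{j'}| ≥ c·δ²/min(|j|, |j'|)³. -/
noncomputable section

/-- The finite-volume Floquet Hamiltonian `H_S` on a finite set `S ⊆ ℤ × ℤ`: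
diagonal entries `n + j²`, entries `δ` between `(j,n)` and `(j',n')` with
`|j−j'| = 1` and `|n−n'| = 1`, all other entries `0`. -/
def Hmat (δ : ℝ) (S : Finset (ℤ × ℤ)) : Matrix S S ℝ := fun x y =>
  if (x : ℤ × ℤ) = (y : ℤ × ℤ) then (((x : ℤ × ℤ).2 + (x : ℤ × ℤ).1 ^ 2 : ℤ) : ℝ)
  else if |(x : ℤ × ℤ).1 - (y : ℤ × ℤ).1| = 1 ∧ |(x : ℤ × ℤ).2 - (y : ℤ × ℤ).2| = 1 then δ
  else 0

/-- `μ` is an eigenvalue of the real symmetric matrix `H_S`. -/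
def IsEigen (δ : ℝ) (S : Finset (ℤ × ℤ)) (μ : ℝ) : Prop :=
  ∃ v : S → ℝ, v ≠ 0 ∧ (Hmat δ S).mulVec v = μ • v

/-- The square `Λ_j` of side `2L` centered at `(j, n)`. -/
def sqΛ (j n L : ℤ) : Finset (ℤ × ℤ) :=
  Finset.Icc (j - L) (j + L) ×ˢ Finset.Icc (n - L) (n + L)

/-- The extension by zero of an eigenvector of `H_S` solves the eigenvalue equation on `S`. -/
theorem IsEigen.exists_extension {δ : ℝ} {S : Finset (ℤ × ℤ)} {E : ℝ} (h : IsEigen δ S E) :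
    ∃ w : ℤ → ℤ → ℝ, (∃ a b, w a b ≠ 0) ∧ (∀ a b, (a, b) ∉ S → w a b = 0) ∧
      ∀ a b, (a, b) ∈ S → (((b + a ^ 2 : ℤ) : ℝ) - E) * w a b =
        -δ * (w (a + 1) (b + 1) + w (a + 1) (b - 1) + w (a - 1) (b + 1) + w (a - 1) (b - 1)) := by
  classical
  obtain ⟨v, hv, hE⟩ := h
  have hw : ∀ p : ℤ × ℤ, p ∉ S → (if h : p ∈ S then v ⟨p, h⟩ else 0) = 0 :=
    fun p hp => dif_neg hp
  refine ⟨fun a b => if h : (a, b) ∈ S then v ⟨(a, b), h⟩ else 0, ?_, fun a b => hw (a, b), ?_⟩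
  · obtain ⟨⟨⟨a, b⟩, hx⟩, hvx⟩ := Function.ne_iff.mp hv
    exact ⟨a, b, by simpa [hx] using hvx⟩
  · intro a b hab
    set w : ℤ × ℤ → ℝ := fun p => if h : p ∈ S then v ⟨p, h⟩ else 0 with hwdef
    have hwS : ∀ p, (if p ∈ S then w p else 0) = w p := by
      intro p
      by_cases hp : p ∈ S
      · simp [hp]
      · simp [hp, hwdef]
    have hx := congrFun hE ⟨(a, b), hab⟩
    simp only [Matrix.mulVec, dotProduct, Pi.smul_apply, smul_eq_mul] at hx
    let g : ℤ × ℤ → ℝ := fun p => (if p = (a, b) then ((b + a ^ 2 : ℤ) : ℝ) * w p else 0)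
          + δ * ((if p = (a + 1, b + 1) then w p else 0) + (if p = (a + 1, b - 1) then w p else 0)
          + (if p = (a - 1, b + 1) then w p else 0)
          + (if p = (a - 1, b - 1) then w p else 0))
    have hpt : ∀ y : S, Hmat δ S ⟨(a, b), hab⟩ y * v y = g y := by
      rintro ⟨⟨y₁, y₂⟩, hy⟩
      have hwy : w (y₁, y₂) = v ⟨(y₁, y₂), hy⟩ := by simp [hwdef, hy]
      simp only [g, Hmat, hwy, Prod.mk.injEq]
      by_cases h0 : y₁ = a ∧ y₂ = b
      · obtain ⟨rfl, rfl⟩ := h0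
        simp [show ¬ y₁ = y₁ - 1 by omega]
      · have h0' : ¬ (a = y₁ ∧ b = y₂) := fun h => h0 ⟨h.1.symm, h.2.symm⟩
        rw [if_neg h0', if_neg h0]
        by_cases hc : |a - y₁| = 1 ∧ |b - y₂| = 1
        · rw [if_pos hc]
          have h1 := (abs_eq (zero_le_one' ℤ)).mp hc.1
          have h2 := (abs_eq (zero_le_one' ℤ)).mp hc.2
          rcases h1 with h1 | h1 <;> rcases h2 with h2 | h2
          · obtain rfl : a = y₁ + 1 := by omega
            obtain rfl : b = y₂ + 1 := by omega
            rw [if_neg (by omega), if_neg (by omega), if_neg (by omega), if_pos (by omega)]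
            ring
          · obtain rfl : a = y₁ + 1 := by omega
            obtain rfl : b = y₂ - 1 := by omega
            rw [if_neg (by omega), if_neg (by omega), if_pos (by omega), if_neg (by omega)]
            ring
          · obtain rfl : a = y₁ - 1 := by omega
            obtain rfl : b = y₂ + 1 := by omega
            rw [if_neg (by omega), if_pos (by omega), if_neg (by omega), if_neg (by omega)]
            ring
          · obtain rfl : a = y₁ - 1 := by omega
            obtain rfl : b = y₂ - 1 := by omega
            rw [if_pos (by omega), if_neg (by omega), if_neg (by omega), if_neg (by omega)]
            ring
        · rw [if_neg hc]
          have hc' : ∀ c d : ℤ, |c| = 1 → |d| = 1 → ¬ (y₁ = a + c ∧ y₂ = b + d) := by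
            rintro c d hc1 hd1 ⟨rfl, rfl⟩
            exact hc (by simp [hc1, hd1])
          rw [if_neg (hc' 1 1 (by simp) (by simp)),
            if_neg (by simpa [sub_eq_add_neg] using hc' 1 (-1) (by simp) (by simp)),
            if_neg (by simpa [sub_eq_add_neg] using hc' (-1) 1 (by simp) (by simp)),
            if_neg (by simpa [sub_eq_add_neg] using hc' (-1) (-1) (by simp) (by simp))]
          ring
    rw [Finset.sum_congr rfl (fun y _ => hpt y), Finset.sum_coe_sort S g] at hx
    simp only [g, Finset.sum_add_distrib, ← Finset.mul_sum, Finset.sum_ite_eq', hwS, if_pos hab] at hx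
    have hwv : v ⟨(a, b), hab⟩ = w (a, b) := by simp [hwdef, hab]
    rw [hwv] at hx
    linear_combination hx

/-- In coordinates centred at `(j, -j²)`, reflected so that `j` becomes `|j|`. -/
theorem IsEigen.exists_centered {δ E : ℝ} {j L : ℤ} (h : IsEigen δ (sqΛ j (-j ^ 2) L) E) :
    ∃ ψ : ℤ → ℤ → ℝ, (∃ k m, ψ k m ≠ 0) ∧ (∀ k m, ¬ (|k| ≤ L ∧ |m| ≤ L) → ψ k m = 0) ∧
      ∀ k m, |k| ≤ L → |m| ≤ L → (((m + k * (2 * |j| + k) : ℤ) : ℝ) - E) * ψ k m =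
        -δ * (ψ (k + 1) (m + 1) + ψ (k + 1) (m - 1) + ψ (k - 1) (m + 1) + ψ (k - 1) (m - 1)) := by
  obtain ⟨w, ⟨a, b, hab⟩, hout, heq⟩ := h.exists_extension
  have hmem : ∀ k m : ℤ, (j + k, -j ^ 2 + m) ∈ sqΛ j (-j ^ 2) L ↔ |k| ≤ L ∧ |m| ≤ L := by
    intro k m
    simp only [sqΛ, Finset.mem_product, Finset.mem_Icc, abs_le]
    constructor
    · rintro ⟨⟨_, _⟩, _, _⟩
      exact ⟨⟨by linarith, by linarith⟩, by linarith, by linarith⟩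
    · rintro ⟨⟨_, _⟩, _, _⟩
      exact ⟨⟨by linarith, by linarith⟩, by linarith, by linarith⟩
  rcases le_total 0 j with hj | hj
  · refine ⟨fun k m => w (j + k) (-j ^ 2 + m), ⟨a - j, b + j ^ 2, by simpa using hab⟩,
      fun k m hkm => hout _ _ (by rwa [hmem]), fun k m hk hm => ?_⟩
    have := heq _ _ ((hmem k m).2 ⟨hk, hm⟩)
    rw [abs_of_nonneg hj]
    simp only [add_assoc, add_sub_assoc] at this ⊢
    rw [← this]
    push_cast
    ring
  · refine ⟨fun k m => w (j + -k) (-j ^ 2 + m), ⟨j - a, b + j ^ 2, by simpa using hab⟩,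
      fun k m hkm => hout _ _ (by rwa [hmem, abs_neg]), fun k m hk hm => ?_⟩
    have := heq _ _ ((hmem (-k) m).2 ⟨by rwa [abs_neg], hm⟩)
    rw [abs_of_nonpos hj]
    have e1 : j + -(k + 1) = j + -k - 1 := by ring
    have e2 : j + -(k - 1) = j + -k + 1 := by ring
    have e3 : -j ^ 2 + (m + 1) = -j ^ 2 + m + 1 := by ring
    have e4 : -j ^ 2 + (m - 1) = -j ^ 2 + m - 1 := by ring
    simp only [e1, e2, e3, e4]
    have e5 : ∀ p q r s : ℝ, p + q + r + s = r + s + p + q := by intros; ring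
    rw [e5, ← this]
    push_cast
    ring

/-- The diagonal entry `m + k (2J + k)` is at least `J / 2` in absolute value, or else the site is
the centre, or else it is nonzero and all neighbours have diagonal entry at least `J / 2`. -/
theorem diagonal_trichotomy {J L k m : ℤ} (hJ : 10 ≤ J) (hL : L ≤ 2 * (J - 1))
    (hk : |k| ≤ L) (hm : |m| ≤ L) :
    J ≤ 2 * |m + k * (2 * J + k)| ∨ (k = 0 ∧ m = 0) ∨
      (1 ≤ |m + k * (2 * J + k)| ∧ ∀ s t : ℤ, |s| = 1 → |t| = 1 → |k + s| ≤ L → |m + t| ≤ L →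
        J ≤ 2 * |m + t + (k + s) * (2 * J + (k + s))|) := by
  have hfar : ∀ k m : ℤ, |k| ≤ L → |m| ≤ L → 2 ≤ |k| → J ≤ 2 * |m + k * (2 * J + k)| := by
    intro k m hk hm h2
    rw [abs_le] at hk hm
    rcases le_abs.1 h2 with h | h
    · have : 2 * (2 * J + 2) ≤ k * (2 * J + k) := by nlinarith
      have := le_abs_self (m + k * (2 * J + k))
      linarith
    · have : 2 * (2 * J - 2) ≤ -(k * (2 * J + k)) := by nlinarith
      have := neg_le_abs (m + k * (2 * J + k))
      linarith
  by_cases h2 : 2 ≤ |k|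
  · exact Or.inl (hfar k m hk hm h2)
  by_cases hc : J ≤ 2 * |m + k * (2 * J + k)|
  · exact Or.inl hc
  by_cases h0 : k = 0 ∧ m = 0
  · exact Or.inr (Or.inl h0)
  refine Or.inr (Or.inr ?_)
  have hk3 : k = -1 ∨ k = 0 ∨ k = 1 := by
    rcases abs_cases k with h | h <;> omega
  have hnear : ∀ s t : ℤ, |s| = 1 → |t| = 1 → |k + s| ≤ L → |m + t| ≤ L →
        J ≤ 2 * |m + t + (k + s) * (2 * J + (k + s))| := by
    intro s t hs ht hks hmt
    by_cases h2' : 2 ≤ |k + s|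
    · exact hfar _ _ hks hmt h2'
    have hs' := (abs_eq (zero_le_one' ℤ)).mp hs
    have ht' := (abs_eq (zero_le_one' ℤ)).mp ht
    by_contra hcon
    have h1 := le_abs_self (m + k * (2 * J + k))
    have h2 := neg_le_abs (m + k * (2 * J + k))
    have h3 := le_abs_self (m + t + (k + s) * (2 * J + (k + s)))
    have h4 := neg_le_abs (m + t + (k + s) * (2 * J + (k + s)))
    rcases hk3 with rfl | rfl | rfl <;> rcases hs' with rfl | rfl <;>
      omega
  refine ⟨Int.one_le_abs fun h => ?_, hnear⟩
  have h1 := le_abs_self m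
  rcases hk3 with rfl | rfl | rfl
  · omega
  · omega
  · have h2 := neg_le_abs m
    omega

/-- For an eigenvector centred at a resonant site, all other components are `O(1/J)` relative to the
sup norm. -/
theorem abs_le_of_ne_center {δ E M : ℝ} {J L : ℤ} {ψ : ℤ → ℤ → ℝ} (hδ0 : 0 < δ) (hδ1 : δ < 1 / 4)
    (hE : |E| ≤ 1 / 2) (hJ : 10 ≤ J) (hL : L ≤ 2 * (J - 1))
    (hout : ∀ k m, ¬ (|k| ≤ L ∧ |m| ≤ L) → ψ k m = 0)
    (heq : ∀ k m, |k| ≤ L → |m| ≤ L → (((m + k * (2 * J + k) : ℤ) : ℝ) - E) * ψ k m =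
        -δ * (ψ (k + 1) (m + 1) + ψ (k + 1) (m - 1) + ψ (k - 1) (m + 1) + ψ (k - 1) (m - 1)))
    (hM : ∀ k m, |ψ k m| ≤ M) (k m : ℤ) (hkm : ¬ (k = 0 ∧ m = 0)) :
    |ψ k m| ≤ 8 * M / J := by
  have hJr : (10 : ℝ) ≤ J := by exact_mod_cast hJ
  have hM0 : 0 ≤ M := (abs_nonneg _).trans (hM 0 0)
  have hstep : ∀ (k m : ℤ) (B : ℝ), |k| ≤ L → |m| ≤ L →
      |ψ (k + 1) (m + 1)| ≤ B → |ψ (k + 1) (m - 1)| ≤ B → |ψ (k - 1) (m + 1)| ≤ B →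
      |ψ (k - 1) (m - 1)| ≤ B →
      (|((m + k * (2 * J + k) : ℤ) : ℝ)| - 1 / 2) * |ψ k m| ≤ B := by
    intro k m B hk hm h1 h2 h3 h4
    have h := congrArg abs (heq k m hk hm)
    rw [abs_mul, abs_mul, abs_neg, abs_of_pos hδ0] at h
    have ha : |((m + k * (2 * J + k) : ℤ) : ℝ)| - 1 / 2 ≤ |((m + k * (2 * J + k) : ℤ) : ℝ) - E| := by
      linarith [abs_sub_abs_le_abs_sub ((m + k * (2 * J + k) : ℤ) : ℝ) E]
    have hs : |ψ (k + 1) (m + 1) + ψ (k + 1) (m - 1) + ψ (k - 1) (m + 1) + ψ (k - 1) (m - 1)|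
        ≤ 4 * B := by
      rw [abs_le] at *
      constructor <;> linarith
    calc _ ≤ |((m + k * (2 * J + k) : ℤ) : ℝ) - E| * |ψ k m| :=
          mul_le_mul_of_nonneg_right ha (abs_nonneg _)
      _ ≤ (1 / 4) * (4 * B) := by
          rw [h]
          exact mul_le_mul hδ1.le hs (abs_nonneg _) (by norm_num)
      _ = B := by ring
  have hlarge : ∀ k m : ℤ, |k| ≤ L → |m| ≤ L → J ≤ 2 * |m + k * (2 * J + k)| →
      |ψ k m| ≤ 4 * M / J := by
    intro k m hk hm hD
    have h := hstep k m M hk hm (hM _ _) (hM _ _) (hM _ _) (hM _ _)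
    have hD' : (J : ℝ) ≤ 2 * |((m + k * (2 * J + k) : ℤ) : ℝ)| := by exact_mod_cast hD
    rw [le_div_iff₀ (by linarith)]
    nlinarith [abs_nonneg (ψ k m)]
  by_cases hin : |k| ≤ L ∧ |m| ≤ L
  swap
  · rw [hout k m hin, abs_zero]
    positivity
  obtain ⟨hk, hm⟩ := hin
  have hB : 4 * M / J ≤ 8 * M / J := by gcongr; norm_num
  have hB0 : 0 ≤ 4 * M / J := by positivity
  rcases diagonal_trichotomy hJ hL hk hm with hD | h0 | ⟨hD, hnb⟩
  · exact (hlarge k m hk hm hD).trans hB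
  · exact absurd h0 hkm
  · have hn : ∀ s t : ℤ, |s| = 1 → |t| = 1 → |ψ (k + s) (m + t)| ≤ 4 * M / J := by
      intro s t hs ht
      by_cases hin : |k + s| ≤ L ∧ |m + t| ≤ L
      · exact hlarge _ _ hin.1 hin.2 (hnb s t hs ht hin.1 hin.2)
      · rw [hout _ _ hin, abs_zero]
        exact hB0
    have h := hstep k m (4 * M / J) hk hm (hn 1 1 (by simp) (by simp))
      (hn 1 (-1) (by simp) (by simp)) (hn (-1) 1 (by simp) (by simp))
      (hn (-1) (-1) (by simp) (by simp))
    have hD' : (1 : ℝ) ≤ |((m + k * (2 * J + k) : ℤ) : ℝ)| := by exact_mod_cast hD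
    have : 8 * M / J = 2 * (4 * M / J) := by ring
    rw [this]
    nlinarith [abs_nonneg (ψ k m)]

/-- Cancellation between the components at two sites with nearly opposite diagonal entries. -/
theorem abs_add_le_of_opposite {δ J a b x y A B r s t : ℝ} (hδ0 : 0 < δ) (hδ1 : δ < 1 / 4)
    (hJ : 0 < J) (ha : J ≤ a) (hb : J ≤ b) (hab : |a - b| ≤ t) (hx : a * x = -δ * A)
    (hy : b * y = δ * B) (hr : |A - B| ≤ r) (hs : |A| ≤ s) :
    |x + y| ≤ (r * J⁻¹ + t * s * J⁻¹ ^ 2) / 4 := by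
  have ha0 : 0 < a := hJ.trans_le ha
  have hb0 : 0 < b := hJ.trans_le hb
  have hr0 : 0 ≤ r := (abs_nonneg _).trans hr
  have hs0 : 0 ≤ s := (abs_nonneg _).trans hs
  have ht0 : 0 ≤ t := (abs_nonneg _).trans hab
  have hxy : x + y = δ * (-(A - B) / b + (a - b) * A / (a * b)) := by
    field_simp
    linear_combination b * hx + a * hy
  have h1 : |-(A - B) / b| ≤ r / J := by
    rw [abs_div, abs_neg, abs_of_pos hb0]
    gcongr
  have h2 : |(a - b) * A / (a * b)| ≤ t * s / (J * J) := by
    rw [abs_div, abs_mul, abs_of_pos (mul_pos ha0 hb0)]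
    gcongr
  rw [hxy, abs_mul, abs_of_pos hδ0]
  have h3 := (abs_add_le (-(A - B) / b) ((a - b) * A / (a * b))).trans (add_le_add h1 h2)
  calc _ ≤ (1 / 4) * (r / J + t * s / (J * J)) := by gcongr
    _ = _ := by
      field_simp

set_option maxHeartbeats 1000000 in
/-- Second order expansion of the eigenvalue, from a priori bounds near the centre. -/
theorem abs_sub_le_of_normalized {δ E J : ℝ} {p : ℤ → ℤ → ℝ} (hδ0 : 0 < δ) (hδ1 : δ < 1 / 4)
    (hE : |E| ≤ 1 / 2) (hJ : 1000 ≤ J) (hp : p 0 0 = 1)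
    (hp1 : ∀ k m : ℤ, ¬ (k = 0 ∧ m = 0) → |p k m| ≤ 8 * J⁻¹)
    (heq : ∀ k m : ℤ, |k| ≤ 5 → |m| ≤ 5 → ((m : ℝ) + k * (2 * J + k) - E) * p k m =
        -δ * (p (k + 1) (m + 1) + p (k + 1) (m - 1) + p (k - 1) (m + 1) + p (k - 1) (m - 1))) :
    |E - δ ^ 2 * J⁻¹ ^ 2| ≤ 20 * J⁻¹ ^ 4 := by
  have hJ0 : 0 < J := by linarith
  have hE1 := abs_le.1 hE
  have hp2 : ∀ k m : ℤ, 1 ≤ |k| → |k| ≤ 3 → |m| ≤ 5 → (|k| = 1 → |m| ≠ 1) →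
      |p k m| ≤ 8 * J⁻¹ ^ 2 := by
    intro k m hk1 hk3 hm hkm
    have h := congrArg abs (heq k m (by omega) hm)
    have hn : ∀ s t : ℤ, |s| = 1 → |t| = 1 → |p (k + s) (m + t)| ≤ 8 * J⁻¹ := by
      intro s t hs ht
      refine hp1 _ _ ?_
      rintro ⟨h1, h2⟩
      rw [show s = -k by omega, abs_neg] at hs
      rw [show t = -m by omega, abs_neg] at ht
      exact hkm hs ht
    have h1 := hn 1 1 (by simp) (by simp)
    have h2 := hn 1 (-1) (by simp) (by simp)
    have h3 := hn (-1) 1 (by simp) (by simp)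
    have h4 := hn (-1) (-1) (by simp) (by simp)
    simp only [← sub_eq_add_neg] at h2 h3 h4
    have hsum : |p (k + 1) (m + 1) + p (k + 1) (m - 1) + p (k - 1) (m + 1) + p (k - 1) (m - 1)|
        ≤ 32 * J⁻¹ := by
      rw [abs_le] at h1 h2 h3 h4 ⊢
      constructor <;> linarith
    have hD : J ≤ |(m : ℝ) + k * (2 * J + k) - E| := by
      have hm' : |(m : ℝ)| ≤ 5 := by exact_mod_cast hm
      rw [abs_le] at hm'
      have hk : k = 1 ∨ k = 2 ∨ k = 3 ∨ k = -1 ∨ k = -2 ∨ k = -3 := by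
        rcases abs_cases k with h | h <;> omega
      rw [le_abs]
      rcases hk with rfl | rfl | rfl | rfl | rfl | rfl <;> push_cast <;>
        first
        | (left; linarith)
        | (right; linarith)
    rw [abs_mul, abs_mul, abs_neg, abs_of_pos hδ0] at h
    have h5 : J * |p k m| ≤ 1 / 4 * (32 * J⁻¹) :=
      calc J * |p k m| ≤ |(m : ℝ) + k * (2 * J + k) - E| * |p k m| := by gcongr
        _ ≤ _ := by rw [h]; gcongr
    calc |p k m| = J⁻¹ * (J * |p k m|) := by field_simp
      _ ≤ J⁻¹ * (1 / 4 * (32 * J⁻¹)) := by gcongr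
      _ = _ := by ring
  have e1_1 : (2 * J + 2 - E) * p 1 1 =
      -δ * (p 2 2 + p 2 0 + p 0 2 + 1) := by
    have := heq 1 1 (by norm_num) (by norm_num)
    norm_num [hp] at this
    linear_combination this
  have en1_1 : (2 * J + (-2) + E) * p (-1) 1 =
      δ * (p 0 2 + 1 + p (-2) 2 + p (-2) 0) := by
    have := heq (-1) 1 (by norm_num) (by norm_num)
    norm_num [hp] at this
    linear_combination -this
  have e1_n1 : (2 * J + 0 - E) * p 1 (-1) =
      -δ * (p 2 0 + p 2 (-2) + 1 + p 0 (-2)) := by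
    have := heq 1 (-1) (by norm_num) (by norm_num)
    norm_num [hp] at this
    linear_combination this
  have en1_n1 : (2 * J + 0 + E) * p (-1) (-1) =
      δ * (1 + p 0 (-2) + p (-2) 0 + p (-2) (-2)) := by
    have := heq (-1) (-1) (by norm_num) (by norm_num)
    norm_num [hp] at this
    linear_combination -this
  have e1_3 : (2 * J + 4 - E) * p 1 3 =
      -δ * (p 2 4 + p 2 2 + p 0 4 + p 0 2) := by
    have := heq 1 3 (by norm_num) (by norm_num)
    norm_num [hp] at this
    linear_combination this
  have en1_3 : (2 * J + (-4) + E) * p (-1) 3 =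
      δ * (p 0 4 + p 0 2 + p (-2) 4 + p (-2) 2) := by
    have := heq (-1) 3 (by norm_num) (by norm_num)
    norm_num [hp] at this
    linear_combination -this
  have e1_n3 : (2 * J + (-2) - E) * p 1 (-3) =
      -δ * (p 2 (-2) + p 2 (-4) + p 0 (-2) + p 0 (-4)) := by
    have := heq 1 (-3) (by norm_num) (by norm_num)
    norm_num [hp] at this
    linear_combination this
  have en1_n3 : (2 * J + 2 + E) * p (-1) (-3) =
      δ * (p 0 (-2) + p 0 (-4) + p (-2) (-2) + p (-2) (-4)) := by
    have := heq (-1) (-3) (by norm_num) (by norm_num)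
    norm_num [hp] at this
    linear_combination -this
  have e2_0 : (4 * J + 4 - E) * p 2 0 =
      -δ * (p 3 1 + p 3 (-1) + p 1 1 + p 1 (-1)) := by
    have := heq 2 0 (by norm_num) (by norm_num)
    norm_num [hp] at this
    linear_combination this
  have en2_0 : (4 * J + (-4) + E) * (-p (-2) 0) =
      δ * (-(p (-1) 1 + p (-1) (-1) + p (-3) 1 + p (-3) (-1))) := by
    have := heq (-2) 0 (by norm_num) (by norm_num)
    norm_num [hp] at this
    linear_combination this
  have e2_2 : (4 * J + 6 - E) * p 2 2 =
      -δ * (p 3 3 + p 3 1 + p 1 3 + p 1 1) := by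
    have := heq 2 2 (by norm_num) (by norm_num)
    norm_num [hp] at this
    linear_combination this
  have en2_2 : (4 * J + (-6) + E) * (-p (-2) 2) =
      δ * (-(p (-1) 3 + p (-1) 1 + p (-3) 3 + p (-3) 1)) := by
    have := heq (-2) 2 (by norm_num) (by norm_num)
    norm_num [hp] at this
    linear_combination this
  have e2_n2 : (4 * J + 2 - E) * p 2 (-2) =
      -δ * (p 3 (-1) + p 3 (-3) + p 1 (-1) + p 1 (-3)) := by
    have := heq 2 (-2) (by norm_num) (by norm_num)
    norm_num [hp] at this
    linear_combination this
  have en2_n2 : (4 * J + (-2) + E) * (-p (-2) (-2)) =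
      δ * (-(p (-1) (-1) + p (-1) (-3) + p (-3) (-1) + p (-3) (-3))) := by
    have := heq (-2) (-2) (by norm_num) (by norm_num)
    norm_num [hp] at this
    linear_combination this
  have e0_0 : (0 - E) * 1 = -δ * (p 1 1 + p 1 (-1) + p (-1) 1 + p (-1) (-1)) := by
    have := heq 0 0 (by norm_num) (by norm_num)
    norm_num [hp] at this
    linear_combination -this
  have e0_2 : (2 - E) * p 0 2 = -δ * (p 1 3 + p 1 1 + p (-1) 3 + p (-1) 1) := by
    have := heq 0 2 (by norm_num) (by norm_num)
    norm_num [hp] at this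
    linear_combination this
  have e0_n2 : (-2 - E) * p 0 (-2) = -δ * (p 1 (-1) + p 1 (-3) + p (-1) (-1) + p (-1) (-3)) := by
    have := heq 0 (-2) (by norm_num) (by norm_num)
    norm_num [hp] at this
    linear_combination this
  have b0_2 := abs_le.1 (hp1 0 2 (by norm_num))
  have b0_n2 := abs_le.1 (hp1 0 (-2) (by norm_num))
  have b0_4 := abs_le.1 (hp1 0 4 (by norm_num))
  have b0_n4 := abs_le.1 (hp1 0 (-4) (by norm_num))
  have b1_1 := abs_le.1 (hp1 1 1 (by norm_num))
  have b1_n1 := abs_le.1 (hp1 1 (-1) (by norm_num))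
  have bn1_1 := abs_le.1 (hp1 (-1) 1 (by norm_num))
  have bn1_n1 := abs_le.1 (hp1 (-1) (-1) (by norm_num))
  have b1_3 := abs_le.1 (hp2 1 3 (by norm_num) (by norm_num) (by norm_num) (by norm_num))
  have b1_n3 := abs_le.1 (hp2 1 (-3) (by norm_num) (by norm_num) (by norm_num) (by norm_num))
  have bn1_3 := abs_le.1 (hp2 (-1) 3 (by norm_num) (by norm_num) (by norm_num) (by norm_num))
  have bn1_n3 := abs_le.1 (hp2 (-1) (-3) (by norm_num) (by norm_num) (by norm_num) (by norm_num))
  have b2_0 := abs_le.1 (hp2 2 0 (by norm_num) (by norm_num) (by norm_num) (by norm_num))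
  have b2_2 := abs_le.1 (hp2 2 2 (by norm_num) (by norm_num) (by norm_num) (by norm_num))
  have b2_n2 := abs_le.1 (hp2 2 (-2) (by norm_num) (by norm_num) (by norm_num) (by norm_num))
  have b2_4 := abs_le.1 (hp2 2 4 (by norm_num) (by norm_num) (by norm_num) (by norm_num))
  have b2_n4 := abs_le.1 (hp2 2 (-4) (by norm_num) (by norm_num) (by norm_num) (by norm_num))
  have bn2_0 := abs_le.1 (hp2 (-2) 0 (by norm_num) (by norm_num) (by norm_num) (by norm_num))
  have bn2_2 := abs_le.1 (hp2 (-2) 2 (by norm_num) (by norm_num) (by norm_num) (by norm_num))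
  have bn2_n2 := abs_le.1 (hp2 (-2) (-2) (by norm_num) (by norm_num) (by norm_num) (by norm_num))
  have bn2_4 := abs_le.1 (hp2 (-2) 4 (by norm_num) (by norm_num) (by norm_num) (by norm_num))
  have bn2_n4 := abs_le.1 (hp2 (-2) (-4) (by norm_num) (by norm_num) (by norm_num) (by norm_num))
  have b3_1 := abs_le.1 (hp2 3 1 (by norm_num) (by norm_num) (by norm_num) (by norm_num))
  have b3_n1 := abs_le.1 (hp2 3 (-1) (by norm_num) (by norm_num) (by norm_num) (by norm_num))
  have b3_3 := abs_le.1 (hp2 3 3 (by norm_num) (by norm_num) (by norm_num) (by norm_num))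
  have b3_n3 := abs_le.1 (hp2 3 (-3) (by norm_num) (by norm_num) (by norm_num) (by norm_num))
  have bn3_1 := abs_le.1 (hp2 (-3) 1 (by norm_num) (by norm_num) (by norm_num) (by norm_num))
  have bn3_n1 := abs_le.1 (hp2 (-3) (-1) (by norm_num) (by norm_num) (by norm_num) (by norm_num))
  have bn3_3 := abs_le.1 (hp2 (-3) 3 (by norm_num) (by norm_num) (by norm_num) (by norm_num))
  have bn3_n3 := abs_le.1 (hp2 (-3) (-3) (by norm_num) (by norm_num) (by norm_num) (by norm_num))
  clear heq hp1 hp2 hp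
  have hh0 : 0 < J⁻¹ := inv_pos.2 hJ0
  have hh1 : J⁻¹ ≤ 1 / 1000 := by
    rw [one_div]
    exact inv_anti₀ (by norm_num) hJ
  have hJh : J * J⁻¹ = 1 := mul_inv_cancel₀ hJ0.ne'
  have hcancel := fun a b x y A B r s t : ℝ =>
    @abs_add_le_of_opposite δ J a b x y A B r s t hδ0 hδ1 hJ0
  set h := J⁻¹ with hh
  clear_value h
  have hh2 : h ^ 2 ≤ h / 1000 := by nlinarith only [hh0, hh1]
  have hh3 : h ^ 3 ≤ h ^ 2 / 1000 := by nlinarith only [hh1, sq_nonneg h]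
  have hh2' : 0 < h ^ 2 := by positivity
  have hh3' : 0 < h ^ 3 := by positivity
  have hh4' : 0 < h ^ 4 := by positivity
  have s1 : |p 1 1 + p (-1) 1| ≤ 3 * h ^ 2 := by
    refine (hcancel _ _ _ _ _ _ (32 * h ^ 2) 2 5 ?_ ?_ ?_ e1_1 en1_1 ?_ ?_).trans ?_
    · linarith only [hE1.1, hE1.2, hJ]
    · linarith only [hE1.1, hE1.2, hJ]
    · rw [abs_le]
      constructor <;> linarith only [hE1.1, hE1.2, hJ]
    · rw [abs_le]
      constructor <;> linarith only [b2_2.1, b2_2.2, b2_0.1, b2_0.2, bn2_2.1, bn2_2.2, bn2_0.1,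
        bn2_0.2, hh2, hh3, hh0, hh2', hh3', hh4']
    · rw [abs_le]
      constructor <;> linarith only [b2_2.1, b2_2.2, b2_0.1, b2_0.2, b0_2.1, b0_2.2, hh2, hh3,
        hh0, hh2', hh3', hh4', hh1]
    · linarith only [hh3, hh2', hh3', hh4']
  have sn1 : |p 1 (-1) + p (-1) (-1)| ≤ 3 * h ^ 2 := by
    refine (hcancel _ _ _ _ _ _ (32 * h ^ 2) 2 1 ?_ ?_ ?_ e1_n1 en1_n1 ?_ ?_).trans ?_
    · linarith only [hE1.1, hE1.2, hJ]
    · linarith only [hE1.1, hE1.2, hJ]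
    · rw [abs_le]
      constructor <;> linarith only [hE1.1, hE1.2, hJ]
    · rw [abs_le]
      constructor <;> linarith only [b2_0.1, b2_0.2, b2_n2.1, b2_n2.2, bn2_0.1, bn2_0.2, bn2_n2.1,
        bn2_n2.2, hh2, hh3, hh0, hh2', hh3', hh4']
    · rw [abs_le]
      constructor <;> linarith only [b2_0.1, b2_0.2, b2_n2.1, b2_n2.2, b0_n2.1, b0_n2.2, hh2, hh3,
        hh0, hh2', hh3', hh4', hh1]
    · linarith only [hh3, hh2', hh3', hh4']
  have s3 : |p 1 3 + p (-1) 3| ≤ 50 * h ^ 3 := by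
    refine (hcancel _ _ _ _ _ _ (32 * h ^ 2) (17 * h) 9 ?_ ?_ ?_ e1_3 en1_3 ?_ ?_).trans ?_
    · linarith only [hE1.1, hE1.2, hJ]
    · linarith only [hE1.1, hE1.2, hJ]
    · rw [abs_le]
      constructor <;> linarith only [hE1.1, hE1.2, hJ]
    · rw [abs_le]
      constructor <;> linarith only [b2_4.1, b2_4.2, b2_2.1, b2_2.2, bn2_4.1, bn2_4.2, bn2_2.1,
        bn2_2.2, hh2, hh3, hh0, hh2', hh3', hh4']
    · rw [abs_le]
      constructor <;> linarith only [b2_4.1, b2_4.2, b2_2.1, b2_2.2, b0_4.1, b0_4.2, b0_2.1,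
        b0_2.2, hh2, hh3, hh0, hh2', hh3', hh4', hh1]
    · linarith only [hh3, hh2', hh3', hh4']
  have sn3 : |p 1 (-3) + p (-1) (-3)| ≤ 50 * h ^ 3 := by
    refine (hcancel _ _ _ _ _ _ (32 * h ^ 2) (17 * h) 5 ?_ ?_ ?_ e1_n3 en1_n3 ?_ ?_).trans ?_
    · linarith only [hE1.1, hE1.2, hJ]
    · linarith only [hE1.1, hE1.2, hJ]
    · rw [abs_le]
      constructor <;> linarith only [hE1.1, hE1.2, hJ]
    · rw [abs_le]
      constructor <;> linarith only [b2_n2.1, b2_n2.2, b2_n4.1, b2_n4.2, bn2_n2.1, bn2_n2.2,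
        bn2_n4.1, bn2_n4.2, hh2, hh3, hh0, hh2', hh3', hh4']
    · rw [abs_le]
      constructor <;> linarith only [b2_n2.1, b2_n2.2, b2_n4.1, b2_n4.2, b0_n2.1, b0_n2.2,
        b0_n4.1, b0_n4.2, hh2, hh3, hh0, hh2', hh3', hh4', hh1]
    · linarith only [hh3, hh2', hh3', hh4']
  rw [abs_le] at s1 sn1 s3 sn3
  have hE2 : |E| ≤ 2 * h ^ 2 := by
    have hE0 : E = δ * ((p 1 1 + p (-1) 1) + (p 1 (-1) + p (-1) (-1))) := by
      linear_combination -e0_0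
    have hsum : |(p 1 1 + p (-1) 1) + (p 1 (-1) + p (-1) (-1))| ≤ 6 * h ^ 2 := by
      rw [abs_le]
      constructor <;> linarith only [s1.1, s1.2, sn1.1, sn1.2]
    rw [hE0, abs_mul, abs_of_pos hδ0]
    calc _ ≤ 1 / 4 * (6 * h ^ 2) := by gcongr
      _ ≤ 2 * h ^ 2 := by linarith only [hh2']
  rw [abs_le] at hE2
  have c2 : |p 0 2| ≤ h ^ 2 := by
    have hsum : |(p 1 3 + p 1 1 + p (-1) 3 + p (-1) 1)| ≤ 4 * h ^ 2 := by
      rw [abs_le]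
      constructor <;> linarith only [s1.1, s1.2, s3.1, s3.2, hh2, hh3, hh0, hh2', hh3', hh4']
    have ha : 1 ≤ |2 - E| := by
      rw [le_abs]
      left
      linarith only [hE1.1, hE1.2]
    have he := congrArg abs e0_2
    rw [abs_mul, abs_mul, abs_neg, abs_of_pos hδ0] at he
    calc |p 0 2| ≤ |2 - E| * |p 0 2| := le_mul_of_one_le_left (abs_nonneg _) ha
      _ ≤ 1 / 4 * (4 * h ^ 2) := by rw [he]; gcongr
      _ = h ^ 2 := by ring
  have cn2 : |p 0 (-2)| ≤ h ^ 2 := by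
    have hsum : |(p 1 (-1) + p 1 (-3) + p (-1) (-1) + p (-1) (-3))| ≤ 4 * h ^ 2 := by
      rw [abs_le]
      constructor <;> linarith only [sn1.1, sn1.2, sn3.1, sn3.2, hh2, hh3, hh0, hh2', hh3', hh4']
    have ha : 1 ≤ |-2 - E| := by
      rw [le_abs]
      right
      linarith only [hE1.1, hE1.2]
    have he := congrArg abs e0_n2
    rw [abs_mul, abs_mul, abs_neg, abs_of_pos hδ0] at he
    calc |p 0 (-2)| ≤ |-2 - E| * |p 0 (-2)| := le_mul_of_one_le_left (abs_nonneg _) ha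
      _ ≤ 1 / 4 * (4 * h ^ 2) := by rw [he]; gcongr
      _ = h ^ 2 := by ring
  rw [abs_le] at c2 cn2
  have t0 : |p 2 0 + -p (-2) 0| ≤ 50 * h ^ 3 := by
    refine (hcancel _ _ _ _ _ _ (38 * h ^ 2) (17 * h) 9 ?_ ?_ ?_ e2_0 en2_0 ?_ ?_).trans ?_
    · linarith only [hE1.1, hE1.2, hJ]
    · linarith only [hE1.1, hE1.2, hJ]
    · rw [abs_le]
      constructor <;> linarith only [hE1.1, hE1.2, hJ]
    · rw [abs_le]
      constructor <;> linarith only [s1.1, s1.2, sn1.1, sn1.2, b3_1.1, b3_1.2, b3_n1.1, b3_n1.2,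
        bn3_1.1, bn3_1.2, bn3_n1.1, bn3_n1.2, hh2, hh3, hh0, hh2', hh3', hh4']
    · rw [abs_le]
      constructor <;> linarith only [b3_1.1, b3_1.2, b3_n1.1, b3_n1.2, b1_1.1, b1_1.2, b1_n1.1,
        b1_n1.2, hh2, hh3, hh0, hh2', hh3', hh4', hh1]
    · linarith only [hh3, hh2', hh3', hh4']
  have t2 : |p 2 2 + -p (-2) 2| ≤ 50 * h ^ 3 := by
    refine (hcancel _ _ _ _ _ _ (38 * h ^ 2) (9 * h) (13) ?_ ?_ ?_ e2_2 en2_2 ?_ ?_).trans ?_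
    · linarith only [hE1.1, hE1.2, hJ]
    · linarith only [hE1.1, hE1.2, hJ]
    · rw [abs_le]
      constructor <;> linarith only [hE1.1, hE1.2, hJ]
    · rw [abs_le]
      constructor <;> linarith only [s1.1, s1.2, s3.1, s3.2, b3_3.1, b3_3.2, b3_1.1, b3_1.2,
        bn3_3.1, bn3_3.2, bn3_1.1, bn3_1.2, hh2, hh3, hh0, hh2', hh3', hh4']
    · rw [abs_le]
      constructor <;> linarith only [b3_3.1, b3_3.2, b3_1.1, b3_1.2, b1_3.1, b1_3.2, b1_1.1,
        b1_1.2, hh2, hh3, hh0, hh2', hh3', hh4', hh1]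
    · linarith only [hh3, hh2', hh3', hh4']
  have tn2 : |p 2 (-2) + -p (-2) (-2)| ≤ 50 * h ^ 3 := by
    refine (hcancel _ _ _ _ _ _ (38 * h ^ 2) (9 * h) 5 ?_ ?_ ?_ e2_n2 en2_n2 ?_ ?_).trans ?_
    · linarith only [hE1.1, hE1.2, hJ]
    · linarith only [hE1.1, hE1.2, hJ]
    · rw [abs_le]
      constructor <;> linarith only [hE1.1, hE1.2, hJ]
    · rw [abs_le]
      constructor <;> linarith only [sn1.1, sn1.2, sn3.1, sn3.2, b3_n1.1, b3_n1.2, b3_n3.1,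
        b3_n3.2, bn3_n1.1, bn3_n1.2, bn3_n3.1, bn3_n3.2, hh2, hh3, hh0, hh2', hh3', hh4']
    · rw [abs_le]
      constructor <;> linarith only [b3_n1.1, b3_n1.2, b3_n3.1, b3_n3.2, b1_n1.1, b1_n1.2,
        b1_n3.1, b1_n3.2, hh2, hh3, hh0, hh2', hh3', hh4', hh1]
    · linarith only [hh3, hh2', hh3', hh4']
  rw [abs_le] at t0 t2 tn2
  have u : |p 1 (-1) + p (-1) (-1)| ≤ 30 * h ^ 4 := by
    refine (hcancel _ _ _ _ _ _ (100 * h ^ 3) (2) (4 * h ^ 2) ?_ ?_ ?_ e1_n1 en1_n1 ?_ ?_).trans ?_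
    · linarith only [hE1.1, hE1.2, hJ]
    · linarith only [hE1.1, hE1.2, hJ]
    · rw [abs_le]
      constructor <;> linarith only [hE2.1, hE2.2]
    · rw [abs_le]
      constructor <;> linarith only [t0.1, t0.2, tn2.1, tn2.2, hh2, hh3, hh0, hh2', hh3', hh4']
    · rw [abs_le]
      constructor <;> linarith only [b2_0.1, b2_0.2, b2_n2.1, b2_n2.2, b0_n2.1, b0_n2.2, hh2, hh3,
        hh0, hh2', hh3', hh4', hh1]
    · linarith only [hh3, hh2', hh3', hh4']
  have v : |p 1 1 + p (-1) 1 - δ * h ^ 2| ≤ 50 * h ^ 4 := by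
    set A := p 2 2 + p 2 0 + p 0 2 + 1 with hA
    set B := p 0 2 + 1 + p (-2) 2 + p (-2) 0 with hB
    have ha : J ≤ 2 * J + 2 - E := by linarith only [hJ, hE1.1, hE1.2]
    have hb : J ≤ 2 * J + -2 + E := by linarith only [hJ, hE1.1, hE1.2]
    have ha0 := hJ0.trans_le ha
    have hb0 := hJ0.trans_le hb
    have hAB : |A - B| ≤ 100 * h ^ 3 := by
      rw [abs_le]
      constructor <;> linarith only [t0.1, t0.2, t2.1, t2.2, hA, hB]
    have hA1 : |A - 1| ≤ 17 * h ^ 2 := by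
      rw [abs_le]
      constructor <;> linarith only [c2.1, c2.2, b2_0.1, b2_0.2, b2_2.1, b2_2.2, hA]
    have hnum : |4 * (A - 1) - 2 * E * A + (2 - E) ^ 2 * h ^ 2| ≤ 85 * h ^ 2 := by
      have hA2 : |A| ≤ 2 := by
        rw [abs_le] at hA1 ⊢
        constructor <;> linarith only [hA1.1, hA1.2, hh2, hh1]
      have h1 : |E * A| ≤ 2 * h ^ 2 * 2 := by
        rw [abs_mul]
        have := abs_le.2 hE2
        gcongr
      have h2 : (2 - E) ^ 2 * h ^ 2 ≤ 9 * h ^ 2 := by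
        gcongr
        nlinarith only [hE1.1, hE1.2]
      have h3 : 0 ≤ (2 - E) ^ 2 * h ^ 2 := by positivity
      rw [abs_le] at hA1 h1 ⊢
      constructor <;> linarith only [hA1.1, hA1.2, h1.1, h1.2, h2, h3, hh2']
    have hdec : p 1 1 + p (-1) 1 - δ * h ^ 2 = δ * (-(A - B) / (2 * J + -2 + E) +
        (4 * (A - 1) - 2 * E * A + (2 - E) ^ 2 * h ^ 2) /
          ((2 * J + 2 - E) * (2 * J + -2 + E))) := by
      have hx : p 1 1 = -δ * A / (2 * J + 2 - E) := by
        rw [eq_div_iff ha0.ne']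
        linear_combination e1_1
      have hy : p (-1) 1 = δ * B / (2 * J + -2 + E) := by
        rw [eq_div_iff hb0.ne']
        linear_combination en1_1
      rw [hx, hy]
      have ha1 := ha0.ne'
      have hb1 := hb0.ne'
      generalize hat : 2 * J + 2 - E = a at *
      generalize hbt : 2 * J + -2 + E = b at *
      have hprod : h ^ 2 * (a * b) = 4 - (2 - E) ^ 2 * h ^ 2 := by
        rw [← hat, ← hbt]
        linear_combination (4 * J * h + 4) * hJh
      have hdiff : a - b = 4 - 2 * E := by
        rw [← hat, ← hbt]
        ring
      field_simp
      linear_combination A * hdiff - hprod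
    have h1 : |-(A - B) / (2 * J + -2 + E)| ≤ 100 * h ^ 3 / J := by
      rw [abs_div, abs_neg, abs_of_pos hb0]
      gcongr
    have h2 : |(4 * (A - 1) - 2 * E * A + (2 - E) ^ 2 * h ^ 2) /
        ((2 * J + 2 - E) * (2 * J + -2 + E))| ≤ 85 * h ^ 2 / (J * J) := by
      rw [abs_div, abs_of_pos (mul_pos ha0 hb0)]
      gcongr
    rw [hdec, abs_mul, abs_of_pos hδ0]
    calc _ ≤ 1 / 4 * (100 * h ^ 3 / J + 85 * h ^ 2 / (J * J)) := by
          gcongr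
          exact (abs_add_le _ _).trans (add_le_add h1 h2)
      _ = 185 / 4 * h ^ 4 := by
          rw [hh]
          field_simp
          norm_num
      _ ≤ 50 * h ^ 4 := by linarith only [hh4']
  have hfin : E - δ ^ 2 * h ^ 2 =
      δ * ((p 1 1 + p (-1) 1 - δ * h ^ 2) + (p 1 (-1) + p (-1) (-1))) := by
    linear_combination -e0_0
  rw [hfin, abs_mul, abs_of_pos hδ0]
  calc _ ≤ 1 / 4 * (50 * h ^ 4 + 30 * h ^ 4) := by
        gcongr
        exact (abs_add_le _ _).trans (add_le_add v u)
    _ = 20 * h ^ 4 := by ring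

/-- An eigenvalue of `H_{Λ_j}` close to `0` is `δ² / j² + O(j⁻⁴)`. -/
theorem IsEigen.abs_sub_le {δ E : ℝ} {j L : ℤ} (hδ0 : 0 < δ) (hδ1 : δ < 1 / 4)
    (hE : E ∈ Set.Icc (-(2 * δ)) (2 * δ)) (hj : 1000 ≤ |j|) (hjL : |j| ≤ L)
    (hL : L ≤ 2 * (|j| - 1)) (h : IsEigen δ (sqΛ j (-j ^ 2) L) E) :
    |E - δ ^ 2 * |(j : ℝ)|⁻¹ ^ 2| ≤ 20 * |(j : ℝ)|⁻¹ ^ 4 := by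
  obtain ⟨ψ, ⟨k₀, m₀, hne⟩, hout, heq⟩ := h.exists_centered
  have hE' : |E| ≤ 1 / 2 := by
    rw [abs_le]
    constructor <;> linarith [hE.1, hE.2]
  obtain ⟨⟨k₁, m₁⟩, -, hmax⟩ := Finset.exists_max_image
    (Finset.Icc (-L) L ×ˢ Finset.Icc (-L) L) (fun x : ℤ × ℤ => |ψ x.1 x.2|)
    ⟨(0, 0), by simp; omega⟩
  have hM : ∀ k m, |ψ k m| ≤ |ψ k₁ m₁| := by
    intro k m
    by_cases hin : |k| ≤ L ∧ |m| ≤ L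
    · exact hmax (k, m) (by simpa [abs_le, and_assoc] using hin)
    · rw [hout k m hin, abs_zero]
      exact abs_nonneg _
  have hpos : 0 < |ψ k₁ m₁| := (abs_pos.2 hne).trans_le (hM k₀ m₀)
  have hbound := abs_le_of_ne_center hδ0 hδ1 hE' (by omega) hL hout heq hM
  have hjr : (1000 : ℝ) ≤ |(j : ℝ)| := by exact_mod_cast hj
  have hcenter : k₁ = 0 ∧ m₁ = 0 := by
    by_contra hc
    have := hbound k₁ m₁ hc
    push_cast at this
    rw [le_div_iff₀ (by linarith)] at this
    nlinarith
  rw [hcenter.1, hcenter.2] at hpos hbound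
  have h0 : ψ 0 0 ≠ 0 := abs_pos.1 hpos
  refine abs_sub_le_of_normalized (p := fun k m => ψ k m / ψ 0 0) hδ0 hδ1 hE' hjr (div_self h0)
    (fun k m hkm => ?_) (fun k m hk hm => ?_)
  · rw [abs_div, div_le_iff₀ hpos]
    refine (hbound k m hkm).trans_eq ?_
    push_cast
    ring
  · have := heq k m (by omega) (by omega)
    push_cast at this
    field_simp
    linear_combination this

/-- eigenvalue spacing. The eigenvalues of `H_{Λ_j}` and `H_{Λ_j'}`
in `[−2δ, 2δ]` are separated by `c δ² / min(|j|, |j'|)³` when `|j| ≠ |j'|`. -/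
theorem eigenvalue_spacing (δ : ℝ) (hδ0 : 0 < δ) (hδ1 : δ < 1 / 4) :
    ∃ j₀ : ℤ, ∃ c > (0 : ℝ),
      ∀ j j' L L' : ℤ, j₀ < |j| → j₀ < |j'| → |j| ≠ |j'| →
        |j| ≤ L → L ≤ 2 * (|j| - 1) → |j'| ≤ L' → L' ≤ 2 * (|j'| - 1) →
        ∀ E E' : ℝ,
          IsEigen δ (sqΛ j (-j ^ 2) L) E → E ∈ Set.Icc (-(2 * δ)) (2 * δ) →
          IsEigen δ (sqΛ j' (-j' ^ 2) L') E' → E' ∈ Set.Icc (-(2 * δ)) (2 * δ) →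
          c * δ ^ 2 / (min |(j : ℝ)| |(j' : ℝ)|) ^ 3 ≤ |E - E'| := by
  obtain ⟨N, hN⟩ := exists_nat_ge (160 / δ ^ 2)
  refine ⟨max 1000 N, 1 / 4, by norm_num, ?_⟩
  have key : ∀ (j j' : ℤ) (E E' : ℝ), max 1000 (N : ℤ) < |j| → |j| < |j'| →
      |E - δ ^ 2 * |(j : ℝ)|⁻¹ ^ 2| ≤ 20 * |(j : ℝ)|⁻¹ ^ 4 →
      |E' - δ ^ 2 * |(j' : ℝ)|⁻¹ ^ 2| ≤ 20 * |(j' : ℝ)|⁻¹ ^ 4 →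
      1 / 4 * δ ^ 2 / |(j : ℝ)| ^ 3 ≤ E - E' := by
    intro j j' E E' hj hjj' hE hE'
    have hj1 : (1000 : ℝ) < |(j : ℝ)| := by exact_mod_cast (le_max_left _ _).trans_lt hj
    have hj2 : (N : ℝ) < |(j : ℝ)| := by exact_mod_cast (le_max_right _ _).trans_lt hj
    have hj3 : |(j : ℝ)| + 1 ≤ |(j' : ℝ)| := by exact_mod_cast hjj'
    generalize |(j : ℝ)| = x at *
    generalize |(j' : ℝ)| = y at *
    have hx0 : 0 < x := by linarith
    have hδx : 160 ≤ δ ^ 2 * x := by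
      have := (hN.trans hj2.le)
      rwa [div_le_iff₀ (by positivity), mul_comm] at this
    have hyx : y⁻¹ ≤ (x + 1)⁻¹ := inv_anti₀ (by linarith) hj3
    have hy0 : 0 < y⁻¹ := inv_pos.2 (by linarith)
    have hgap : 1 / 2 * x⁻¹ ^ 3 ≤ x⁻¹ ^ 2 - (x + 1)⁻¹ ^ 2 := by
      have : x⁻¹ ^ 2 - (x + 1)⁻¹ ^ 2 - 1 / 2 * x⁻¹ ^ 3 =
          (3 * x ^ 2 - 1) / (2 * x ^ 3 * (x + 1) ^ 2) := by
        field_simp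
        ring
      have h2 : 0 ≤ (3 * x ^ 2 - 1) / (2 * x ^ 3 * (x + 1) ^ 2) :=
        div_nonneg (by nlinarith) (by positivity)
      linarith
    have hy2 : y⁻¹ ^ 2 ≤ (x + 1)⁻¹ ^ 2 := by gcongr
    have hy4 : y⁻¹ ^ 4 ≤ x⁻¹ ^ 4 := by
      have : y⁻¹ ≤ x⁻¹ := inv_anti₀ hx0 (by linarith)
      gcongr
    have hx4 : 160 * x⁻¹ ^ 4 ≤ δ ^ 2 * x⁻¹ ^ 3 :=
      calc 160 * x⁻¹ ^ 4 ≤ δ ^ 2 * x * x⁻¹ ^ 4 := by gcongr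
        _ = δ ^ 2 * x⁻¹ ^ 3 := by field_simp
    have hmain : δ ^ 2 * (1 / 2 * x⁻¹ ^ 3) ≤ δ ^ 2 * (x⁻¹ ^ 2 - y⁻¹ ^ 2) := by
      gcongr
      linarith
    rw [div_eq_mul_inv, ← inv_pow]
    have := (abs_le.1 hE).1
    have := (abs_le.1 hE').2
    linarith
  intro j j' L L' hj hj' hne hjL hL hjL' hL' E E' hEig hE hEig' hE'
  have h1 := hEig.abs_sub_le hδ0 hδ1 hE (by omega) hjL hL
  have h2 := hEig'.abs_sub_le hδ0 hδ1 hE' (by omega) hjL' hL'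
  rcases lt_or_gt_of_ne hne with hlt | hlt
  · rw [min_eq_left (by exact_mod_cast hlt.le)]
    exact (key j j' E E' hj hlt h1 h2).trans (le_abs_self _)
  · rw [min_eq_right (by exact_mod_cast hlt.le), abs_sub_comm]
    exact (key j' j E' E hj' hlt h2 h1).trans (le_abs_self _)
end
end

section
/- There exist δ₀ > 0 and c > 0 such that for every δ with 0 < δ < δ₀, every eigenvalue μ of the real symmetric matrix H_Λ with Λ = ([−8, 8] ∩ ℤ)² that satisfies |μ| ≤ 2δ in fact satisfies |μ| ≥ c·δ². -/
noncomputable section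

/-- The sum of `u` over the four diagonal neighbours of `(j, n)`. -/
def diagSum (u : ℤ × ℤ → ℝ) (j n : ℤ) : ℝ :=
  u (j + 1, n + 1) + u (j + 1, n - 1) + u (j - 1, n + 1) + u (j - 1, n - 1)

/-- `u` is supported in `S`, bounded by `1`, and solves the eigenvalue equation of `H_S`. -/
structure IsNormalizedSolution (δ : ℝ) (S : Finset (ℤ × ℤ)) (μ : ℝ) (u : ℤ × ℤ → ℝ) : Prop where
  eq_zero : ∀ p, p ∉ S → u p = 0
  abs_le_one : ∀ p, |u p| ≤ 1
  eqn : ∀ j n, (j, n) ∈ S → ((n + j ^ 2 : ℤ) : ℝ) * u (j, n) + δ * diagSum u j n = μ * u (j, n)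

lemma Hmat_kernel_eq (δ : ℝ) (j n : ℤ) (y : ℤ × ℤ) :
    (if (j, n) = y then ((n + j ^ 2 : ℤ) : ℝ)
      else if |j - y.1| = 1 ∧ |n - y.2| = 1 then δ else 0) =
    (if (j, n) = y then ((n + j ^ 2 : ℤ) : ℝ) else 0) +
      ((if (j + 1, n + 1) = y then δ else 0) + (if (j + 1, n - 1) = y then δ else 0) +
        (if (j - 1, n + 1) = y then δ else 0) + (if (j - 1, n - 1) = y then δ else 0)) := by
  obtain ⟨a, b⟩ := y
  simp only [Prod.mk.injEq]
  by_cases h0 : j = a ∧ n = b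
  · obtain ⟨rfl, rfl⟩ := h0
    simp
  · rw [if_neg h0, if_neg h0]
    by_cases h : |j - a| = 1 ∧ |n - b| = 1
    · rw [if_pos h]
      obtain ⟨h1, h2⟩ := h
      rcases (abs_eq zero_le_one).1 h1 with h1 | h1 <;>
        rcases (abs_eq zero_le_one).1 h2 with h2 | h2
      · obtain rfl : a = j - 1 := by omega
        obtain rfl : b = n - 1 := by omega
        rw [if_neg (by omega), if_neg (by omega), if_neg (by omega), if_pos (by omega)]
        ring
      · obtain rfl : a = j - 1 := by omega
        obtain rfl : b = n + 1 := by omega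
        rw [if_neg (by omega), if_neg (by omega), if_pos (by omega), if_neg (by omega)]
        ring
      · obtain rfl : a = j + 1 := by omega
        obtain rfl : b = n - 1 := by omega
        rw [if_neg (by omega), if_pos (by omega), if_neg (by omega), if_neg (by omega)]
        ring
      · obtain rfl : a = j + 1 := by omega
        obtain rfl : b = n + 1 := by omega
        rw [if_pos (by omega), if_neg (by omega), if_neg (by omega), if_neg (by omega)]
        ring
    · rw [if_neg h]
      rw [abs_eq zero_le_one, abs_eq zero_le_one] at h
      rw [if_neg (by omega), if_neg (by omega), if_neg (by omega), if_neg (by omega)]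
      ring

/-- An eigenvector, extended by zero and scaled to have maximum modulus `1`. -/
lemma IsEigen.exists_isNormalizedSolution {δ μ : ℝ} {S : Finset (ℤ × ℤ)} (h : IsEigen δ S μ) :
    ∃ u, IsNormalizedSolution δ S μ u ∧ ∃ p ∈ S, |u p| = 1 := by
  obtain ⟨v, hv, hH⟩ := h
  obtain ⟨x₀, hx₀⟩ := Function.ne_iff.1 hv
  obtain ⟨p, -, hp⟩ := Finset.exists_max_image Finset.univ (fun x => |v x|) ⟨x₀, Finset.mem_univ _⟩
  have hpos : 0 < |v p| := (abs_pos.2 hx₀).trans_le (hp x₀ (Finset.mem_univ _))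
  set u : ℤ × ℤ → ℝ := fun x => if hx : x ∈ S then v ⟨x, hx⟩ / |v p| else 0 with hu
  have hus : ∀ x : S, u x = v x / |v p| := fun x => by simp [hu]
  have hu0 : ∀ x, x ∉ S → u x = 0 := fun x hx => by simp [hu, hx]
  refine ⟨u, ⟨hu0, fun x => ?_, fun j n hjn => ?_⟩, p, p.2, ?_⟩
  · by_cases hx : x ∈ S
    · rw [hus ⟨x, hx⟩, abs_div, abs_abs, div_le_one hpos]
      exact hp _ (Finset.mem_univ _)
    · simp [hu0 x hx]
  · have h1 := congrFun hH ⟨(j, n), hjn⟩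
    have h2 : ∑ y : S, Hmat δ S ⟨(j, n), hjn⟩ y * u y = μ * u (j, n) := by
      rw [hus ⟨(j, n), hjn⟩, mul_div_assoc', ← smul_eq_mul μ, ← Pi.smul_apply, ← h1,
        Matrix.mulVec, dotProduct, Finset.sum_div]
      exact Finset.sum_congr rfl fun y _ => by rw [hus, mul_div_assoc']
    have pick : ∀ (z : ℤ × ℤ) (c : ℝ), ∑ y ∈ S, (if z = y then c else 0) * u y = c * u z := by
      intro z c
      simp only [ite_mul, zero_mul, Finset.sum_ite_eq]
      split_ifs with hz
      · rfl
      · rw [hu0 z hz, mul_zero]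
    simp only [Hmat, Hmat_kernel_eq] at h2
    rw [Finset.sum_coe_sort S (fun y => ((if (j, n) = y then ((n + j ^ 2 : ℤ) : ℝ) else 0) +
      ((if (j + 1, n + 1) = y then δ else 0) + (if (j + 1, n - 1) = y then δ else 0) +
        (if (j - 1, n + 1) = y then δ else 0) + (if (j - 1, n - 1) = y then δ else 0))) * u y)]
      at h2
    simp only [add_mul, Finset.sum_add_distrib, pick] at h2
    rw [← h2, diagSum]
    ring
  · rw [hus, abs_div, abs_abs, div_self hpos.ne']

/-- The box `([−8, 8] ∩ ℤ)²`. -/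
abbrev box8 : Finset (ℤ × ℤ) := Finset.Icc (-8 : ℤ) 8 ×ˢ Finset.Icc (-8 : ℤ) 8

namespace IsNormalizedSolution

variable {δ μ : ℝ} {S : Finset (ℤ × ℤ)} {u : ℤ × ℤ → ℝ}

lemma reflect (h : IsNormalizedSolution δ box8 μ u) :
    IsNormalizedSolution δ box8 μ fun p => u (-p.1, p.2) where
  eq_zero p hp := h.eq_zero _ fun hq => hp <| by
    simp only [Finset.mem_product, Finset.mem_Icc] at hq ⊢
    omega
  abs_le_one p := h.abs_le_one _
  eqn j n hjn := by
    have := h.eqn (-j) n (by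
      simp only [Finset.mem_product, Finset.mem_Icc] at hjn ⊢
      omega)
    simp only [diagSum, neg_sq, neg_add, neg_sub, ← sub_eq_add_neg] at this ⊢
    rw [← this, show -j - 1 = -1 - j by ring, show -j + 1 = 1 - j by ring]
    ring

/-- A normalized solution is `O(δ)` off the parabola `n = -j²`. -/
lemma abs_le_of_ne (h : IsNormalizedSolution δ S μ u) (hδ : 0 < δ) (hμ : |μ| ≤ 1 / 2)
    {j n : ℤ} (hd : n + j ^ 2 ≠ 0) : |u (j, n)| ≤ 8 * δ := by
  by_cases hS : (j, n) ∈ S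
  · have he := h.eqn j n hS
    have hd1 : (1 : ℝ) ≤ |((n + j ^ 2 : ℤ) : ℝ)| := by
      rw [← Int.cast_abs]
      exact_mod_cast Int.one_le_abs hd
    have hd2 : 1 / 2 ≤ |((n + j ^ 2 : ℤ) : ℝ) - μ| := by
      linarith [abs_sub_abs_le_abs_sub ((n + j ^ 2 : ℤ) : ℝ) μ]
    have hs : |diagSum u j n| ≤ 4 := by
      unfold diagSum
      have h1 := abs_le.1 (h.abs_le_one (j + 1, n + 1))
      have h2 := abs_le.1 (h.abs_le_one (j + 1, n - 1))
      have h3 := abs_le.1 (h.abs_le_one (j - 1, n + 1))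
      have h4 := abs_le.1 (h.abs_le_one (j - 1, n - 1))
      exact abs_le.2 ⟨by linarith, by linarith⟩
    have hm : |((n + j ^ 2 : ℤ) : ℝ) - μ| * |u (j, n)| = δ * |diagSum u j n| := by
      rw [← abs_mul, show (((n + j ^ 2 : ℤ) : ℝ) - μ) * u (j, n) = -(δ * diagSum u j n) by
        linarith, abs_neg, abs_mul, abs_of_pos hδ]
    nlinarith [abs_nonneg (u (j, n))]
  · rw [h.eq_zero _ hS, abs_zero]
    positivity

/-- Second-order expansion at a site off the parabola. -/
lemma exists_expansion (h : IsNormalizedSolution δ S μ u) (hδ : 0 < δ) (hμ : |μ| ≤ δ ^ 2)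
    (hδ' : δ ≤ 1 / 2) {j n : ℤ} (hS : (j, n) ∈ S) (hd : n + j ^ 2 ≠ 0) {a : ℝ}
    (ha : |diagSum u j n - a| ≤ 24 * δ) :
    ∃ e : ℝ, |e| ≤ 32 ∧ ((n + j ^ 2 : ℤ) : ℝ) * u (j, n) = -(δ * a) + δ ^ 2 * e := by
  have hb := h.abs_le_of_ne hδ (by nlinarith) hd
  have hμu : |μ * u (j, n)| ≤ 8 * δ ^ 2 := by
    rw [abs_mul]
    have := mul_le_mul hμ hb (abs_nonneg _) (by positivity)
    nlinarith [sq_nonneg δ]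
  have hsum : |δ * (diagSum u j n - a)| ≤ 24 * δ ^ 2 := by
    rw [abs_mul, abs_of_pos hδ]
    nlinarith
  refine ⟨(((n + j ^ 2 : ℤ) : ℝ) * u (j, n) + δ * a) / δ ^ 2, ?_, by field_simp; ring⟩
  rw [abs_div, abs_of_pos (by positivity : (0 : ℝ) < δ ^ 2), div_le_iff₀ (by positivity)]
  have he := h.eqn j n hS
  rw [show ((n + j ^ 2 : ℤ) : ℝ) * u (j, n) + δ * a =
    μ * u (j, n) - δ * (diagSum u j n - a) by linarith]
  linarith [abs_sub (μ * u (j, n)) (δ * (diagSum u j n - a))]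

/-- Second-order expansion at a site with a single neighbour on the parabola. -/
lemma exists_expansion_of_three (h : IsNormalizedSolution δ S μ u) (hδ : 0 < δ) (hμ : |μ| ≤ δ ^ 2)
    (hδ' : δ ≤ 1 / 2) {j n : ℤ} (q p₁ p₂ p₃ : ℤ × ℤ) (hS : (j, n) ∈ S) (hd : n + j ^ 2 ≠ 0)
    (h₁ : p₁.2 + p₁.1 ^ 2 ≠ 0) (h₂ : p₂.2 + p₂.1 ^ 2 ≠ 0) (h₃ : p₃.2 + p₃.1 ^ 2 ≠ 0)
    (hs : diagSum u j n = u q + u p₁ + u p₂ + u p₃) :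
    ∃ e : ℝ, |e| ≤ 32 ∧ ((n + j ^ 2 : ℤ) : ℝ) * u (j, n) = -(δ * u q) + δ ^ 2 * e := by
  have hμ' : |μ| ≤ 1 / 2 := by nlinarith
  refine h.exists_expansion hδ hμ hδ' hS hd ?_
  have b₁ := abs_le.1 (h.abs_le_of_ne hδ hμ' h₁)
  have b₂ := abs_le.1 (h.abs_le_of_ne hδ hμ' h₂)
  have b₃ := abs_le.1 (h.abs_le_of_ne hδ hμ' h₃)
  rw [hs]
  exact abs_le.2 ⟨by linarith, by linarith⟩

lemma abs_two_le (h : IsNormalizedSolution δ box8 μ u) (hδ : 0 < δ) (hμ : |μ| ≤ δ ^ 2 / 100)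
    (hδ' : δ ≤ 1 / 1000) : |u (2, -4)| ≤ 1 / 2 := by
  have hμ' : |μ| ≤ δ ^ 2 := by nlinarith [sq_nonneg δ]
  have expand := @exists_expansion_of_three δ μ box8 u h hδ hμ' (by linarith)
  obtain ⟨e₁, b₁, h₁⟩ := @expand 3 (-3) (2, -4) (4, -2) (4, -4) (2, -2) (by decide)
    (by decide) (by decide) (by decide) (by decide) (by norm_num [diagSum]; ring)
  obtain ⟨e₂, b₂, h₂⟩ := @expand 3 (-5) (2, -4) (4, -4) (4, -6) (2, -6) (by decide)
    (by decide) (by decide) (by decide) (by decide) (by norm_num [diagSum]; ring)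
  obtain ⟨e₃, b₃, h₃⟩ := @expand 1 (-3) (2, -4) (2, -2) (0, -2) (0, -4) (by decide)
    (by decide) (by decide) (by decide) (by decide) (by norm_num [diagSum]; ring)
  obtain ⟨e₄, b₄, h₄⟩ := @expand 1 (-5) (2, -4) (2, -6) (0, -4) (0, -6) (by decide)
    (by decide) (by decide) (by decide) (by decide) (by norm_num [diagSum])
  have h₀ := h.eqn 2 (-4) (by decide)
  norm_num [diagSum] at h₀ h₁ h₂ h₃ h₄
  obtain ⟨m, rfl⟩ : ∃ m, μ = δ ^ 2 * m := ⟨μ / δ ^ 2, by field_simp⟩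
  have hm : |m| ≤ 1 / 100 := by
    rw [abs_mul, abs_of_pos (by positivity : (0 : ℝ) < δ ^ 2)] at hμ
    exact le_of_mul_le_mul_left (by linarith) (by positivity : (0 : ℝ) < δ ^ 2)
  have hmu : |m * u (2, -4)| ≤ 1 / 100 := by
    rw [abs_mul]
    nlinarith [abs_nonneg m, abs_nonneg (u (2, -4)), h.abs_le_one (2, -4)]
  have key : u (2, -4) / 3 = m * u (2, -4) - δ * (e₁ / 6 + e₂ / 4 - e₃ / 2 - e₄ / 4) := by
    have hne : δ ^ 2 ≠ 0 := by positivity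
    refine mul_left_cancel₀ hne ?_
    linear_combination h₀ - δ / 6 * h₁ - δ / 4 * h₂ + δ / 2 * h₃ + δ / 4 * h₄
  rw [abs_le] at b₁ b₂ b₃ b₄ hmu
  have hE : |e₁ / 6 + e₂ / 4 - e₃ / 2 - e₄ / 4| ≤ 40 := abs_le.2 ⟨by linarith, by linarith⟩
  have hδE : |δ * (e₁ / 6 + e₂ / 4 - e₃ / 2 - e₄ / 4)| ≤ 1 / 25 := by
    rw [abs_mul, abs_of_pos hδ]
    nlinarith
  rw [abs_le] at hδE ⊢
  exact ⟨by linarith, by linarith⟩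

lemma abs_zero_le (h : IsNormalizedSolution δ box8 μ u) (hδ : 0 < δ) (hμ : |μ| ≤ δ ^ 2 / 100)
    (hδ' : δ ≤ 1 / 1000) : |u (0, 0)| ≤ 1 / 2 := by
  have hμ' : |μ| ≤ 1 / 2 := by nlinarith
  have b₁ := abs_le.1 (h.abs_le_of_ne hδ hμ' (show (0 : ℤ) + 2 ^ 2 ≠ 0 by decide))
  have b₂ := abs_le.1 (h.abs_le_of_ne hδ hμ' (show (-2 : ℤ) + 2 ^ 2 ≠ 0 by decide))
  have b₃ := abs_le.1 (h.abs_le_of_ne hδ hμ' (show (-2 : ℤ) + 0 ^ 2 ≠ 0 by decide))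
  have h₀ := h.eqn 1 (-1) (by decide)
  norm_num [diagSum] at h₀
  obtain ⟨m, rfl⟩ : ∃ m, μ = δ * m := ⟨μ / δ, by field_simp⟩
  have hm : |m| ≤ 1 / 100 := by
    rw [abs_mul, abs_of_pos hδ] at hμ
    exact le_of_mul_le_mul_left (by nlinarith) hδ
  have hmu : |m * u (1, -1)| ≤ 1 / 100 := by
    rw [abs_mul]
    nlinarith [abs_nonneg m, abs_nonneg (u (1, -1)), h.abs_le_one (1, -1)]
  have key : u (2, 0) + u (2, -2) + u (0, 0) + u (0, -2) = m * u (1, -1) :=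
    mul_left_cancel₀ hδ.ne' (by linear_combination h₀)
  rw [abs_le] at hmu ⊢
  exact ⟨by linarith, by linarith⟩

lemma abs_one_add_neg_one_le (h : IsNormalizedSolution δ box8 μ u) (hδ : 0 < δ)
    (hμ : |μ| ≤ δ ^ 2 / 100) (hδ' : δ ≤ 1 / 1000) : |u (1, -1) + u (-1, -1)| ≤ 1 / 2 := by
  have hμ' : |μ| ≤ 1 / 2 := by nlinarith
  have b₁ := abs_le.1 (h.abs_le_of_ne hδ hμ' (show (1 : ℤ) + 1 ^ 2 ≠ 0 by decide))
  have b₂ := abs_le.1 (h.abs_le_of_ne hδ hμ' (show (1 : ℤ) + (-1) ^ 2 ≠ 0 by decide))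
  have h₀ := h.eqn 0 0 (by decide)
  norm_num [diagSum] at h₀
  obtain ⟨m, rfl⟩ : ∃ m, μ = δ * m := ⟨μ / δ, by field_simp⟩
  have hm : |m| ≤ 1 / 100 := by
    rw [abs_mul, abs_of_pos hδ] at hμ
    exact le_of_mul_le_mul_left (by nlinarith) hδ
  have hmu : |m * u (0, 0)| ≤ 1 / 100 := by
    rw [abs_mul]
    nlinarith [abs_nonneg m, abs_nonneg (u (0, 0)), h.abs_le_one (0, 0)]
  have key : u (1, 1) + u (1, -1) + u (-1, 1) + u (-1, -1) = m * u (0, 0) :=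
    mul_left_cancel₀ hδ.ne' (by linear_combination h₀)
  rw [abs_le] at hmu ⊢
  exact ⟨by linarith, by linarith⟩

lemma abs_one_sub_neg_one_le (h : IsNormalizedSolution δ box8 μ u) (hδ : 0 < δ)
    (hμ : |μ| ≤ δ ^ 2 / 100) (hδ' : δ ≤ 1 / 1000) : |u (1, -1) - u (-1, -1)| ≤ 1 / 2 := by
  have hμ' : |μ| ≤ δ ^ 2 := by nlinarith [sq_nonneg δ]
  have expand := @exists_expansion_of_three δ μ box8 u h hδ hμ' (by linarith)
  obtain ⟨e₁, b₁, h₁⟩ := @expand 2 0 (1, -1) (3, 1) (3, -1) (1, 1) (by decide)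
    (by decide) (by decide) (by decide) (by decide) (by norm_num [diagSum]; ring)
  obtain ⟨e₂, b₂, h₂⟩ := @expand 2 (-2) (1, -1) (3, -1) (3, -3) (1, -3) (by decide)
    (by decide) (by decide) (by decide) (by decide) (by norm_num [diagSum]; ring)
  obtain ⟨e₃, b₃, h₃⟩ := @expand (-2) 0 (-1, -1) (-3, 1) (-3, -1) (-1, 1) (by decide)
    (by decide) (by decide) (by decide) (by decide) (by norm_num [diagSum]; ring)
  obtain ⟨e₄, b₄, h₄⟩ := @expand (-2) (-2) (-1, -1) (-3, -1) (-3, -3) (-1, -3) (by decide)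
    (by decide) (by decide) (by decide) (by decide) (by norm_num [diagSum]; ring)
  have h₀ := h.eqn 1 (-1) (by decide)
  have h₀' := h.eqn (-1) (-1) (by decide)
  norm_num [diagSum] at h₀ h₀' h₁ h₂ h₃ h₄
  obtain ⟨m, rfl⟩ : ∃ m, μ = δ ^ 2 * m := ⟨μ / δ ^ 2, by field_simp⟩
  have hm : |m| ≤ 1 / 100 := by
    rw [abs_mul, abs_of_pos (by positivity : (0 : ℝ) < δ ^ 2)] at hμ
    exact le_of_mul_le_mul_left (by linarith) (by positivity : (0 : ℝ) < δ ^ 2)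
  have hu : |u (1, -1) - u (-1, -1)| ≤ 2 := by
    linarith [abs_sub (u (1, -1)) (u (-1, -1)), h.abs_le_one (1, -1), h.abs_le_one (-1, -1)]
  have hmu : |m * (u (1, -1) - u (-1, -1))| ≤ 1 / 50 := by
    rw [abs_mul]
    nlinarith [abs_nonneg m, abs_nonneg (u (1, -1) - u (-1, -1))]
  have key : -(3 / 4) * (u (1, -1) - u (-1, -1)) =
      m * (u (1, -1) - u (-1, -1)) - δ * (e₁ / 4 + e₂ / 2 - e₃ / 4 - e₄ / 2) := by
    have hne : δ ^ 2 ≠ 0 := by positivity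
    refine mul_left_cancel₀ hne ?_
    linear_combination h₀ - h₀' - δ / 4 * h₁ - δ / 2 * h₂ + δ / 4 * h₃ + δ / 2 * h₄
  rw [abs_le] at b₁ b₂ b₃ b₄ hmu
  have hE : |e₁ / 4 + e₂ / 2 - e₃ / 4 - e₄ / 2| ≤ 50 := abs_le.2 ⟨by linarith, by linarith⟩
  have hδE : |δ * (e₁ / 4 + e₂ / 2 - e₃ / 4 - e₄ / 2)| ≤ 1 / 20 := by
    rw [abs_mul, abs_of_pos hδ]
    nlinarith
  rw [abs_le] at hδE ⊢
  exact ⟨by linarith, by linarith⟩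

lemma abs_one_le (h : IsNormalizedSolution δ box8 μ u) (hδ : 0 < δ) (hμ : |μ| ≤ δ ^ 2 / 100)
    (hδ' : δ ≤ 1 / 1000) : |u (1, -1)| ≤ 1 / 2 := by
  have h₁ := abs_le.1 (h.abs_one_add_neg_one_le hδ hμ hδ')
  have h₂ := abs_le.1 (h.abs_one_sub_neg_one_le hδ hμ hδ')
  exact abs_le.2 ⟨by linarith, by linarith⟩

lemma abs_le_half (h : IsNormalizedSolution δ box8 μ u) (hδ : 0 < δ) (hμ : |μ| ≤ δ ^ 2 / 100)
    (hδ' : δ ≤ 1 / 1000) {p : ℤ × ℤ} (hp : p ∈ box8) : |u p| ≤ 1 / 2 := by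
  obtain ⟨j, n⟩ := p
  by_cases hd : n + j ^ 2 = 0
  · obtain rfl : n = -j ^ 2 := by linarith
    simp only [Finset.mem_product, Finset.mem_Icc] at hp
    have h₁ : j ≤ 2 := by nlinarith
    have h₂ : -2 ≤ j := by nlinarith
    interval_cases j
    · exact h.reflect.abs_two_le hδ hμ hδ'
    · exact h.reflect.abs_one_le hδ hμ hδ'
    · exact h.abs_zero_le hδ hμ hδ'
    · exact h.abs_one_le hδ hμ hδ'
    · exact h.abs_two_le hδ hμ hδ'
  · linarith [h.abs_le_of_ne hδ (by nlinarith) hd]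

end IsNormalizedSolution

/-- for small `δ`, the eigenvalues of `H_Λ`, `Λ = ([−8, 8] ∩ ℤ)²`,
lying in `[−2δ, 2δ]` are bounded below in absolute value by `c δ²`. -/
theorem small_box_eigenvalue_lower_bound :
    ∃ δ₀ > (0 : ℝ), ∃ c > (0 : ℝ),
      ∀ δ : ℝ, 0 < δ → δ < δ₀ →
        ∀ μ : ℝ, IsEigen δ (Finset.Icc (-8 : ℤ) 8 ×ˢ Finset.Icc (-8 : ℤ) 8) μ →
          |μ| ≤ 2 * δ → c * δ ^ 2 ≤ |μ| := by
  refine ⟨1 / 1000, by norm_num, 1 / 100, by norm_num, fun δ hδ hδ' μ hμ _ => ?_⟩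
  by_contra! hlt
  obtain ⟨u, hu, p, hp, hup⟩ := hμ.exists_isNormalizedSolution
  linarith [hu.abs_le_half hδ (by linarith) hδ'.le hp]
end
end
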